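/- The integral ∫_0^∞ v·arctan(v) / cosh(πv) dv equals -log(2)/2 - 2 log Γ(3/4) + log π - G/π, where G is Catalan's constant. -/

import Mathlib

open MeasureTheory

/-- Catalan's constant `G = ∑_{k≥0} (-1)^k/(2k+1)²`. -/
noncomputable def catalan' : ℝ := ∑' k : ℕ, (-1 : ℝ) ^ k / (2 * (k : ℝ) + 1) ^ 2

open Filter Topology

theorem re_pi_mul_cot_quarter (v : ℝ) :
    ((Real.pi : ℂ) * Complex.cot (Real.pi * ((1 / 4 : ℝ) + (v / 2 : ℝ) * Complex.I))).re =
      Real.pi / Real.cosh (Real.pi * v) := by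
  have h : (Real.pi : ℂ) * ((1 / 4 : ℝ) + (v / 2 : ℝ) * Complex.I) =
      ((Real.pi / 4 : ℝ) : ℂ) + ((Real.pi * v / 2 : ℝ) : ℂ) * Complex.I := by
    push_cast; ring
  have h2 : Real.pi * v = 2 * (Real.pi * v / 2) := by ring
  rw [h, Complex.re_ofReal_mul, Complex.cot, Complex.cos_add_mul_I, Complex.sin_add_mul_I,
    ← Complex.ofReal_cos, ← Complex.ofReal_sin, ← Complex.ofReal_cosh, ← Complex.ofReal_sinh,
    Real.cos_pi_div_four, Real.sin_pi_div_four, h2, Real.cosh_two_mul, ← h2, Complex.div_re]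
  have hC := Real.cosh_sq (Real.pi * v / 2)
  have hC' := Real.cosh_pos (Real.pi * v / 2)
  set C := Real.cosh (Real.pi * v / 2)
  set S := Real.sinh (Real.pi * v / 2)
  have h3 : (√2) ^ 2 = 2 := Real.sq_sqrt (by norm_num)
  simp [Complex.normSq_apply]
  field_simp
  linear_combination hC

theorem hasSum_sech (v : ℝ) :
    HasSum (fun j : ℕ => 2 * (2 * (j : ℝ) + 5 / 2) / ((2 * (j : ℝ) + 5 / 2) ^ 2 + v ^ 2) -
      2 * (2 * (j : ℝ) + 3 / 2) / ((2 * (j : ℝ) + 3 / 2) ^ 2 + v ^ 2))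
      (Real.pi / Real.cosh (Real.pi * v) - 2 * (1 / 2) / ((1 / 2) ^ 2 + v ^ 2)) := by
  set w : ℂ := (1 / 4 : ℝ) + (v / 2 : ℝ) * Complex.I with hw
  have hre : w.re = 1 / 4 := by simp [hw]
  have him : w.im = v / 2 := by simp [hw]
  have hwm : w ∈ Complex.integerComplement := by
    rintro ⟨n, hn⟩
    have := congrArg Complex.re hn
    rw [hre] at this
    simp only [Complex.intCast_re] at this
    have h4 : (4 * n : ℝ) = 1 := by linarith
    have : 4 * n = 1 := by exact_mod_cast h4
    omega
  have hs := (summable_cotTerm hwm).hasSum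
  have e : ∑' n, cotTerm w n = Real.pi * Complex.cot (Real.pi * w) - 1 / w :=
    (cot_series_rep' hwm).symm
  rw [e] at hs
  convert! Complex.hasSum_re hs using 1
  · ext j
    simp only [cotTerm, Complex.add_re, one_div, Complex.inv_re, Complex.sub_re,
      Complex.normSq_apply, Complex.sub_im, Complex.add_im, hre, him]
    simp
    have h1 : 0 < (2 * (j : ℝ) + 5 / 2) ^ 2 + v ^ 2 := by positivity
    have h2 : 0 < (2 * (j : ℝ) + 3 / 2) ^ 2 + v ^ 2 := by positivity
    have e1 : (4⁻¹ + ((j : ℝ) + 1)) * (4⁻¹ + ((j : ℝ) + 1)) + v / 2 * (v / 2) =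
      ((2 * (j : ℝ) + 5 / 2) ^ 2 + v ^ 2) / 4 := by ring
    have e2 : (4⁻¹ - ((j : ℝ) + 1)) * (4⁻¹ - ((j : ℝ) + 1)) + v / 2 * (v / 2) =
      ((2 * (j : ℝ) + 3 / 2) ^ 2 + v ^ 2) / 4 := by ring
    rw [e1, e2]
    field_simp
    ring
  · rw [Complex.sub_re, re_pi_mul_cot_quarter, one_div w, Complex.inv_re, Complex.normSq_apply,
      hre, him]
    congr 1
    have h1 : 0 < (1 / 2 : ℝ) ^ 2 + v ^ 2 := by positivity
    have e1 : (1 / 4 : ℝ) * (1 / 4) + v / 2 * (v / 2) = ((1 / 2 : ℝ) ^ 2 + v ^ 2) / 4 := by ring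
    rw [e1]
    field_simp

theorem hasDerivAt_arctan_div {a : ℝ} (ha : 0 < a) (x : ℝ) :
    HasDerivAt (fun x => Real.arctan (x / a)) (a / (a ^ 2 + x ^ 2)) x := by
  convert! ((hasDerivAt_id x).div_const a).arctan using 1
  simp only [id]
  field_simp

theorem tendsto_arctan_div_atTop {a : ℝ} (ha : 0 < a) :
    Tendsto (fun x => Real.arctan (x / a)) atTop (𝓝 (Real.pi / 2)) :=
  (Real.tendsto_arctan_atTop.mono_right nhdsWithin_le_nhds).comp (tendsto_id.atTop_div_const ha)

theorem tendsto_div_sq_add_sq_atTop (a : ℝ) :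
    Tendsto (fun x : ℝ => x / (a ^ 2 + x ^ 2)) atTop (𝓝 0) := by
  refine squeeze_zero' (g := fun x => x⁻¹) ?_ ?_ tendsto_inv_atTop_zero
  · filter_upwards [eventually_gt_atTop 0] with x hx
    positivity
  · filter_upwards [eventually_gt_atTop 0] with x hx
    rw [div_le_iff₀ (by positivity)]
    field_simp
    nlinarith [sq_nonneg a]

/-- An antiderivative of a product of Lorentzians, including the confluent case. -/
theorem exists_antideriv_lorentzian_mul {a c : ℝ} (ha : 0 < a) (hc : 0 < c) :
    ∃ g : ℝ → ℝ, (∀ x, HasDerivAt g (a / (a ^ 2 + x ^ 2) * (2 * c / (c ^ 2 + x ^ 2))) x) ∧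
      Tendsto g atTop (𝓝 (Real.pi / (a + c))) ∧ g 0 = 0 := by
  by_cases hac : a = c
  · subst hac
    refine ⟨fun x => x / (a ^ 2 + x ^ 2) + 1 / a * Real.arctan (x / a), fun x => ?_, ?_, by simp⟩
    · have hne : a ^ 2 + x ^ 2 ≠ 0 := by positivity
      convert! ((hasDerivAt_id x).div ((hasDerivAt_pow 2 x).const_add (a ^ 2)) hne).add
        ((hasDerivAt_arctan_div ha x).const_mul (1 / a)) using 1
      simp only [id]
      field_simp
      push_cast
      ring
    · convert! (tendsto_div_sq_add_sq_atTop a).add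
        ((tendsto_arctan_div_atTop ha).const_mul (1 / a)) using 2
      field_simp
      ring
  · have hs : c ^ 2 - a ^ 2 ≠ 0 := by
      rw [show c ^ 2 - a ^ 2 = (c - a) * (c + a) by ring]
      exact mul_ne_zero (sub_ne_zero.2 (Ne.symm hac)) (by positivity)
    refine ⟨fun x => 2 / (c ^ 2 - a ^ 2) * (c * Real.arctan (x / a) - a * Real.arctan (x / c)),
      fun x => ?_, ?_, by simp⟩
    · convert! (((hasDerivAt_arctan_div ha x).const_mul c).sub
        ((hasDerivAt_arctan_div hc x).const_mul a)).const_mul (2 / (c ^ 2 - a ^ 2)) using 1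
      field_simp
      ring
    · convert! (((tendsto_arctan_div_atTop ha).const_mul c).sub
        ((tendsto_arctan_div_atTop hc).const_mul a)).const_mul (2 / (c ^ 2 - a ^ 2)) using 2
      field_simp
      ring

theorem integrableOn_lorentzian_mul {a c : ℝ} (ha : 0 < a) (hc : 0 < c) :
    IntegrableOn (fun x => a / (a ^ 2 + x ^ 2) * (2 * c / (c ^ 2 + x ^ 2))) (Set.Ioi 0) := by
  obtain ⟨g, hg, hlim, -⟩ := exists_antideriv_lorentzian_mul ha hc
  exact integrableOn_Ioi_deriv_of_nonneg' (fun x _ => hg x) (fun x _ => by positivity) hlim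

theorem integral_lorentzian_mul {a c : ℝ} (ha : 0 < a) (hc : 0 < c) :
    ∫ x in Set.Ioi 0, a / (a ^ 2 + x ^ 2) * (2 * c / (c ^ 2 + x ^ 2)) = Real.pi / (a + c) := by
  obtain ⟨g, hg, hlim, h0⟩ := exists_antideriv_lorentzian_mul ha hc
  rw [integral_Ioi_of_hasDerivAt_of_nonneg' (fun x _ => hg x) (fun x _ => by positivity) hlim,
    h0, sub_zero]

theorem integrableOn_lorentzian {a : ℝ} (ha : 0 < a) :
    IntegrableOn (fun x => a / (a ^ 2 + x ^ 2)) (Set.Ioi 0) :=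
  integrableOn_Ioi_deriv_of_nonneg' (fun x _ => hasDerivAt_arctan_div ha x)
    (fun x _ => by positivity) (tendsto_arctan_div_atTop ha)

theorem integral_lorentzian {a : ℝ} (ha : 0 < a) :
    ∫ x in Set.Ioi 0, a / (a ^ 2 + x ^ 2) = Real.pi / 2 := by
  rw [integral_Ioi_of_hasDerivAt_of_nonneg' (fun x _ => hasDerivAt_arctan_div ha x)
    (fun x _ => by positivity) (tendsto_arctan_div_atTop ha)]
  simp

theorem continuous_inv_cosh_pi_mul : Continuous fun v : ℝ => 1 / Real.cosh (Real.pi * v) :=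
  continuous_const.div (by fun_prop) fun v => (Real.cosh_pos _).ne'

theorem one_div_cosh_le_one (x : ℝ) : 1 / Real.cosh x ≤ 1 :=
  (div_le_one (Real.cosh_pos x)).2 (Real.one_le_cosh x)

theorem integrableOn_lorentzian_div_cosh {s : ℝ} (hs : 0 < s) :
    IntegrableOn (fun v => s / (s ^ 2 + v ^ 2) * (1 / Real.cosh (Real.pi * v))) (Set.Ioi 0) := by
  refine (integrableOn_lorentzian hs).mul_bdd (c := 1)
    continuous_inv_cosh_pi_mul.aestronglyMeasurable (ae_of_all _ fun v => ?_)
  rw [Real.norm_of_nonneg (one_div_nonneg.2 (Real.cosh_pos _).le)]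
  exact one_div_cosh_le_one _

/-- The integral `∫_0^∞ s / ((s² + v²) cosh(πv)) dv`. -/
noncomputable def lorentzianSechIntegral (s : ℝ) : ℝ :=
  ∫ v in Set.Ioi 0, s / (s ^ 2 + v ^ 2) * (1 / Real.cosh (Real.pi * v))

theorem abs_lorentzian_sub_le {c v : ℝ} (hc : 0 < c) :
    |2 * (c + 1) / ((c + 1) ^ 2 + v ^ 2) - 2 * c / (c ^ 2 + v ^ 2)| ≤ 2 / c ^ 2 := by
  have h1 : 0 < (c + 1) ^ 2 + v ^ 2 := by positivity
  have h2 : 0 < c ^ 2 + v ^ 2 := by positivity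
  have key : 2 * (c + 1) / ((c + 1) ^ 2 + v ^ 2) - 2 * c / (c ^ 2 + v ^ 2) =
      2 * (v ^ 2 - c * (c + 1)) / (((c + 1) ^ 2 + v ^ 2) * (c ^ 2 + v ^ 2)) := by
    field_simp
    ring
  have h3 : |v ^ 2 - c * (c + 1)| ≤ (c + 1) ^ 2 + v ^ 2 := by
    rw [abs_le]
    constructor <;> nlinarith [sq_nonneg v]
  rw [key, abs_div, abs_mul, abs_of_pos (mul_pos h1 h2), abs_two, div_le_div_iff₀ (by positivity)
    (by positivity)]
  have h4 : c ^ 2 ≤ c ^ 2 + v ^ 2 := by nlinarith [sq_nonneg v]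
  have := mul_le_mul h3 h4 (by positivity) h1.le
  linarith

theorem summable_two_div_sq : Summable fun j : ℕ => 2 / (2 * (j : ℝ) + 3 / 2) ^ 2 := by
  have h := (Real.summable_one_div_nat_add_rpow 1 2).2 (by norm_num)
  refine Summable.of_nonneg_of_le (fun j => by positivity) (fun j => ?_) (h.mul_left 2)
  have hj : (0 : ℝ) < (j : ℝ) + 1 := by positivity
  rw [abs_of_pos hj, Real.rpow_two, mul_one_div]
  have : (j : ℝ) + 1 ≤ 2 * (j : ℝ) + 3 / 2 := by linarith
  gcongr

theorem hasSum_lorentzianSechIntegral {s : ℝ} (hs : 0 < s) :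
    HasSum (fun j : ℕ => 1 / (s + (2 * (j : ℝ) + 5 / 2)) - 1 / (s + (2 * (j : ℝ) + 3 / 2)))
      (lorentzianSechIntegral s - 1 / (s + 1 / 2)) := by
  set F : ℕ → ℝ → ℝ := fun j v =>
    s / (s ^ 2 + v ^ 2) * (2 * (2 * (j : ℝ) + 5 / 2) / ((2 * (j : ℝ) + 5 / 2) ^ 2 + v ^ 2)) -
      s / (s ^ 2 + v ^ 2) * (2 * (2 * (j : ℝ) + 3 / 2) / ((2 * (j : ℝ) + 3 / 2) ^ 2 + v ^ 2))
    with hF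
  have hI (j : ℕ) : IntegrableOn (F j) (Set.Ioi 0) :=
    (integrableOn_lorentzian_mul hs (by positivity)).sub
      (integrableOn_lorentzian_mul hs (by positivity))
  have hbound (j : ℕ) (v : ℝ) :
      ‖F j v‖ ≤ s / (s ^ 2 + v ^ 2) * (2 / (2 * (j : ℝ) + 3 / 2) ^ 2) := by
    have h := abs_lorentzian_sub_le (c := 2 * (j : ℝ) + 3 / 2) (v := v) (by positivity)
    rw [show 2 * (j : ℝ) + 3 / 2 + 1 = 2 * j + 5 / 2 by ring] at h
    rw [hF]
    simp only
    rw [← mul_sub, norm_mul, Real.norm_of_nonneg (by positivity), Real.norm_eq_abs]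
    gcongr
  have hsum : Summable fun j => ∫ v in Set.Ioi 0, ‖F j v‖ := by
    refine Summable.of_nonneg_of_le (fun j => by positivity) (fun j => ?_)
      (summable_two_div_sq.mul_left (Real.pi / 2))
    rw [← integral_lorentzian hs, ← integral_mul_const]
    exact integral_mono (hI j).norm ((integrableOn_lorentzian hs).mul_const _) (hbound j)
  have h := hasSum_integral_of_summable_integral_norm hI hsum
  have hval (j : ℕ) : ∫ v in Set.Ioi 0, F j v =
      Real.pi / (s + (2 * (j : ℝ) + 5 / 2)) - Real.pi / (s + (2 * (j : ℝ) + 3 / 2)) := by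
    rw [integral_sub (integrableOn_lorentzian_mul hs (by positivity))
      (integrableOn_lorentzian_mul hs (by positivity)),
      integral_lorentzian_mul hs (by positivity), integral_lorentzian_mul hs (by positivity)]
  have htsum (v : ℝ) : ∑' j, F j v =
      Real.pi * (s / (s ^ 2 + v ^ 2) * (1 / Real.cosh (Real.pi * v))) -
        s / (s ^ 2 + v ^ 2) * (2 * (1 / 2) / ((1 / 2) ^ 2 + v ^ 2)) := by
    have := ((hasSum_sech v).mul_left (s / (s ^ 2 + v ^ 2))).tsum_eq
    simp only [mul_sub] at this
    rw [this]
    ring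
  simp only [hval, htsum] at h
  rw [integral_sub ((integrableOn_lorentzian_div_cosh hs).const_mul _)
    (integrableOn_lorentzian_mul hs (by positivity)), integral_const_mul,
    integral_lorentzian_mul hs (by positivity)] at h
  have hpi := Real.pi_ne_zero
  convert! h.mul_left (1 / Real.pi) using 1
  · ext j
    field_simp
  · rw [← lorentzianSechIntegral]
    field_simp

theorem hasSum_telescope_two {x : ℝ} (hx : 0 < x) :
    HasSum (fun j : ℕ => 1 / (x + 2 * (j : ℝ)) - 1 / (x + 2 * (j : ℝ) + 2)) (1 / x) := by
  rw [hasSum_iff_tendsto_nat_of_nonneg]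
  · have hs (n : ℕ) : ∑ j ∈ Finset.range n, (1 / (x + 2 * (j : ℝ)) - 1 / (x + 2 * (j : ℝ) + 2)) =
        1 / x - 1 / (x + 2 * (n : ℝ)) := by
      have := Finset.sum_range_sub' (fun j : ℕ => 1 / (x + 2 * (j : ℝ))) n
      simp only [Nat.cast_add, Nat.cast_one, Nat.cast_zero, mul_zero, add_zero] at this
      rw [← this]
      refine Finset.sum_congr rfl fun j _ => ?_
      ring_nf
    simp only [hs]
    have : Tendsto (fun n : ℕ => 1 / (x + 2 * (n : ℝ))) atTop (𝓝 0) :=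
      tendsto_const_nhds.div_atTop (tendsto_atTop_add_const_left _ _
        (tendsto_natCast_atTop_atTop.const_mul_atTop two_pos))
    simpa using this.const_sub (1 / x)
  · intro j
    rw [sub_nonneg]
    exact one_div_le_one_div_of_le (by positivity) (by linarith)

theorem lorentzianSechIntegral_add_one {s : ℝ} (hs : 0 < s) :
    lorentzianSechIntegral (s + 1) = 1 / (s + 1 / 2) - lorentzianSechIntegral s := by
  have h := (hasSum_lorentzianSechIntegral hs).add
    (hasSum_lorentzianSechIntegral (s := s + 1) (by positivity))
  have h2 := (hasSum_telescope_two (x := s + 3 / 2) (by positivity)).neg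
  have h3 := h.unique (by
    convert! h2 using 1
    ext j
    ring_nf)
  rw [show s + 1 + 1 / 2 = s + 3 / 2 by ring] at h3
  linarith

theorem hasSum_lorentzianSechIntegral_sub {s : ℝ} (hs : 0 < s) :
    HasSum (fun j : ℕ => (1 / 2) * (1 / (s + (2 * (j : ℝ) + 1 / 2)) -
      2 / (s + (2 * (j : ℝ) + 1 / 2) + 1) + 1 / (s + (2 * (j : ℝ) + 1 / 2) + 2)))
      (lorentzianSechIntegral s - (1 / 2) / (s + 1 / 2)) := by
  convert! (hasSum_lorentzianSechIntegral hs).add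
    ((hasSum_telescope_two (x := s + 1 / 2) (by positivity)).mul_left (1 / 2)) using 1
  · ext j
    ring_nf
  · ring

theorem tendsto_sinh_atTop : Tendsto Real.sinh atTop atTop := by
  refine tendsto_atTop_mono' _ ?_ tendsto_id
  filter_upwards [eventually_ge_atTop 0] with x hx
  exact Real.self_le_sinh_iff.2 hx

theorem hasDerivAt_arctan_sinh (v : ℝ) :
    HasDerivAt (fun v => 1 / Real.pi * Real.arctan (Real.sinh (Real.pi * v)))
      (1 / Real.cosh (Real.pi * v)) v := by
  have h : HasDerivAt (fun v => Real.pi * v) Real.pi v := by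
    simpa using (hasDerivAt_id v).const_mul Real.pi
  convert! (h.sinh.arctan).const_mul (1 / Real.pi) using 1
  have := Real.cosh_sq' (Real.pi * v)
  have h2 := Real.cosh_pos (Real.pi * v)
  rw [← this]
  field_simp

theorem tendsto_arctan_sinh :
    Tendsto (fun v => 1 / Real.pi * Real.arctan (Real.sinh (Real.pi * v))) atTop (𝓝 (1 / 2)) := by
  have h := ((Real.tendsto_arctan_atTop.mono_right nhdsWithin_le_nhds).comp
    (tendsto_sinh_atTop.comp (tendsto_id.const_mul_atTop Real.pi_pos))).const_mul (1 / Real.pi)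
  convert! h using 2
  field_simp

theorem integrableOn_sech : IntegrableOn (fun v => 1 / Real.cosh (Real.pi * v)) (Set.Ioi 0) :=
  integrableOn_Ioi_deriv_of_nonneg' (fun _ _ => hasDerivAt_arctan_sinh _)
    (fun _ _ => one_div_nonneg.2 (Real.cosh_pos _).le) tendsto_arctan_sinh

theorem integral_sech : ∫ v in Set.Ioi 0, 1 / Real.cosh (Real.pi * v) = 1 / 2 := by
  rw [integral_Ioi_of_hasDerivAt_of_nonneg' (fun _ _ => hasDerivAt_arctan_sinh _)
    (fun _ _ => one_div_nonneg.2 (Real.cosh_pos _).le) tendsto_arctan_sinh]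
  simp

theorem integral_sq_lorentzian_div_cosh {s : ℝ} (hs : 0 < s) :
    ∫ v in Set.Ioi 0, v * (v / (v ^ 2 + s ^ 2) + v / (v ^ 2 + (s + 1) ^ 2)) *
      (1 / Real.cosh (Real.pi * v)) = lorentzianSechIntegral s - (1 / 2) / (s + 1 / 2) := by
  have hs1 : 0 < s + 1 := by positivity
  have e (v : ℝ) : v * (v / (v ^ 2 + s ^ 2) + v / (v ^ 2 + (s + 1) ^ 2)) *
      (1 / Real.cosh (Real.pi * v)) = 2 * (1 / Real.cosh (Real.pi * v)) -
        s * (s / (s ^ 2 + v ^ 2) * (1 / Real.cosh (Real.pi * v))) -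
        (s + 1) * ((s + 1) / ((s + 1) ^ 2 + v ^ 2) * (1 / Real.cosh (Real.pi * v))) := by
    have := Real.cosh_pos (Real.pi * v)
    field_simp
    ring
  simp only [e]
  have hI : IntegrableOn (fun v => 2 * (1 / Real.cosh (Real.pi * v)) -
      s * (s / (s ^ 2 + v ^ 2) * (1 / Real.cosh (Real.pi * v)))) (Set.Ioi 0) :=
    (integrableOn_sech.const_mul _).sub ((integrableOn_lorentzian_div_cosh hs).const_mul _)
  rw [integral_sub hI ((integrableOn_lorentzian_div_cosh hs1).const_mul _),
    integral_sub (integrableOn_sech.const_mul _)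
      ((integrableOn_lorentzian_div_cosh hs).const_mul _),
    integral_const_mul, integral_const_mul, integral_const_mul, integral_sech,
    ← lorentzianSechIntegral, ← lorentzianSechIntegral, lorentzianSechIntegral_add_one hs]
  field_simp
  ring

theorem one_sub_one_div_sq_pos {u : ℝ} (hu : 1 < u) : 0 < 1 - 1 / u ^ 2 := by
  rw [sub_pos, div_lt_one (by positivity)]
  nlinarith

theorem hasDerivAt_half_log {y x : ℝ} (hy : 0 < y) (hx : 0 ≤ x) :
    HasDerivAt (fun s => (1 / 2) * Real.log (1 - 1 / (s + y + 1) ^ 2))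
      ((1 / 2) * (1 / (x + y) - 2 / (x + y + 1) + 1 / (x + y + 2))) x := by
  have hu : 1 < x + y + 1 := by linarith
  have hpos := one_sub_one_div_sq_pos hu
  have h1 : HasDerivAt (fun s => s + y + 1) 1 x := ((hasDerivAt_id x).add_const y).add_const 1
  have h2 := (((h1.fun_pow 2).fun_inv (by positivity)).const_sub 1)
  simp only [← one_div] at h2
  convert! (h2.log hpos.ne').const_mul (1 / 2) using 1
  have h4 : x + y + 1 ≠ 0 := by positivity
  have h3 : 1 - 1 / (x + y + 1) ^ 2 = (x + y) * (x + y + 2) / (x + y + 1) ^ 2 := by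
    field_simp
    ring
  rw [h3]
  have h5 : x + y ≠ 0 := by positivity
  have h6 : x + y + 2 ≠ 0 := by positivity
  field_simp
  ring

theorem tendsto_half_log (y : ℝ) :
    Tendsto (fun s : ℝ => (1 / 2) * Real.log (1 - 1 / (s + y + 1) ^ 2)) atTop (𝓝 0) := by
  have h0 : Tendsto (fun s : ℝ => s + y + 1) atTop atTop :=
    tendsto_atTop_add_const_right _ _ (tendsto_atTop_add_const_right _ _ tendsto_id)
  have h1 : Tendsto (fun s : ℝ => 1 - 1 / (s + y + 1) ^ 2) atTop (𝓝 (1 - 0)) :=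
    (tendsto_const_nhds.div_atTop ((tendsto_pow_atTop two_ne_zero).comp h0)).const_sub 1
  have h2 := (h1.log (by norm_num)).const_mul (1 / 2)
  simpa using h2

theorem second_difference_one_div_nonneg {x y : ℝ} (hy : 0 < y) (hx : 0 ≤ x) :
    0 ≤ (1 / 2) * (1 / (x + y) - 2 / (x + y + 1) + 1 / (x + y + 2)) := by
  have h : (1 / 2) * (1 / (x + y) - 2 / (x + y + 1) + 1 / (x + y + 2)) =
      1 / ((x + y) * (x + y + 1) * (x + y + 2)) := by
    have h4 : x + y + 1 ≠ 0 := by positivity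
    have h5 : x + y ≠ 0 := by positivity
    have h6 : x + y + 2 ≠ 0 := by positivity
    field_simp
    ring
  rw [h]
  positivity

theorem integrableOn_second_difference {y : ℝ} (hy : 0 < y) :
    IntegrableOn (fun x => (1 / 2) * (1 / (x + y) - 2 / (x + y + 1) + 1 / (x + y + 2)))
      (Set.Ioi 0) :=
  integrableOn_Ioi_deriv_of_nonneg' (fun _ hx => hasDerivAt_half_log hy hx)
    (fun _ hx => second_difference_one_div_nonneg hy (le_of_lt hx)) (tendsto_half_log y)

theorem integral_second_difference {y : ℝ} (hy : 0 < y) :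
    ∫ x in Set.Ioi 0, (1 / 2) * (1 / (x + y) - 2 / (x + y + 1) + 1 / (x + y + 2)) =
      -((1 / 2) * Real.log (1 - 1 / (y + 1) ^ 2)) := by
  rw [integral_Ioi_of_hasDerivAt_of_nonneg' (fun _ hx => hasDerivAt_half_log hy hx)
    (fun _ hx => second_difference_one_div_nonneg hy (le_of_lt hx)) (tendsto_half_log y)]
  simp

theorem prod_eq_GammaSeq (n : ℕ) (hn : n ≠ 0) :
    ∏ j ∈ Finset.range (n + 1), (1 - 1 / (2 * (j : ℝ) + 1 / 2 + 1) ^ 2) =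
      Real.GammaSeq (3 / 4) n ^ 2 / (Real.GammaSeq (1 / 4) n * Real.GammaSeq (5 / 4) n) := by
  have hn' : (0 : ℝ) < n := by positivity
  have hpow : ((n : ℝ) ^ (3 / 4 : ℝ)) ^ 2 = (n : ℝ) ^ (1 / 4 : ℝ) * (n : ℝ) ^ (5 / 4 : ℝ) := by
    rw [← Real.rpow_natCast, ← Real.rpow_mul hn'.le, ← Real.rpow_add hn']
    norm_num
  have hp (x : ℝ) (hx : 0 < x) : 0 < ∏ j ∈ Finset.range (n + 1), (x + (j : ℝ)) :=
    Finset.prod_pos fun j _ => by positivity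
  have hprod : ∏ j ∈ Finset.range (n + 1), (1 - 1 / (2 * (j : ℝ) + 1 / 2 + 1) ^ 2) =
      (∏ j ∈ Finset.range (n + 1), (1 / 4 + (j : ℝ))) *
        (∏ j ∈ Finset.range (n + 1), (5 / 4 + (j : ℝ))) /
        (∏ j ∈ Finset.range (n + 1), (3 / 4 + (j : ℝ))) ^ 2 := by
    rw [← Finset.prod_pow, ← Finset.prod_mul_distrib, ← Finset.prod_div_distrib]
    refine Finset.prod_congr rfl fun j _ => ?_
    field_simp
    ring
  rw [hprod]
  simp only [Real.GammaSeq]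
  have h1 := hp (1 / 4) (by norm_num)
  have h3 := hp (3 / 4) (by norm_num)
  have h5 := hp (5 / 4) (by norm_num)
  have hf : (0 : ℝ) < n.factorial := by positivity
  have hr1 : 0 < (n : ℝ) ^ (1 / 4 : ℝ) := by positivity
  have hr5 : 0 < (n : ℝ) ^ (5 / 4 : ℝ) := by positivity
  rw [div_pow, mul_pow, hpow]
  generalize (n : ℝ) ^ (1 / 4 : ℝ) = p at *
  generalize (n : ℝ) ^ (5 / 4 : ℝ) = q at *
  generalize (∏ j ∈ Finset.range (n + 1), (1 / 4 + (j : ℝ))) = P1 at *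
  generalize (∏ j ∈ Finset.range (n + 1), (3 / 4 + (j : ℝ))) = P3 at *
  generalize (∏ j ∈ Finset.range (n + 1), (5 / 4 + (j : ℝ))) = P5 at *
  field_simp

theorem hasSum_log_eq_log_Gamma :
    HasSum (fun j : ℕ => -((1 / 2) * Real.log (1 - 1 / (2 * (j : ℝ) + 1 / 2 + 1) ^ 2)))
      (-(Real.log 2) / 2 - 2 * Real.log (Real.Gamma (3 / 4)) + Real.log Real.pi) := by
  have hpos (j : ℕ) : 0 < 1 - 1 / (2 * (j : ℝ) + 1 / 2 + 1) ^ 2 := by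
    refine one_sub_one_div_sq_pos ?_
    have : (0 : ℝ) ≤ j := Nat.cast_nonneg j
    linarith
  rw [hasSum_iff_tendsto_nat_of_nonneg]
  · rw [← tendsto_add_atTop_iff_nat 1]
    have hG (x : ℝ) := Real.GammaSeq_tendsto_Gamma x
    have g1 : 0 < Real.Gamma (1 / 4) := Real.Gamma_pos_of_pos (by norm_num)
    have g3 : 0 < Real.Gamma (3 / 4) := Real.Gamma_pos_of_pos (by norm_num)
    have g5 : 0 < Real.Gamma (5 / 4) := Real.Gamma_pos_of_pos (by norm_num)
    have hrec : Real.Gamma (5 / 4) = 1 / 4 * Real.Gamma (1 / 4) := by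
      rw [← Real.Gamma_add_one (by norm_num)]
      norm_num
    have hrefl : Real.Gamma (1 / 4) = Real.pi * √2 / Real.Gamma (3 / 4) := by
      have h := Real.Gamma_mul_Gamma_one_sub (1 / 4)
      rw [show Real.pi * (1 / 4) = Real.pi / 4 by ring, Real.sin_pi_div_four,
        show (1 - 1 / 4 : ℝ) = 3 / 4 by norm_num] at h
      rw [eq_div_iff g3.ne', h]
      have h2 : √2 * √2 = 2 := Real.mul_self_sqrt (by norm_num)
      have h0 : 0 < √2 := by positivity
      field_simp
      linarith
    have hlim := ((((hG (3 / 4)).pow 2).div ((hG (1 / 4)).mul (hG (5 / 4)))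
      (mul_pos g1 g5).ne').log (by positivity)).const_mul (-(1 / 2))
    have hval : -(1 / 2) * Real.log (Real.Gamma (3 / 4) ^ 2 /
        (Real.Gamma (1 / 4) * Real.Gamma (5 / 4))) =
        -(Real.log 2) / 2 - 2 * Real.log (Real.Gamma (3 / 4)) + Real.log Real.pi := by
      have hpi := Real.pi_pos
      have h0 : √2 ≠ 0 := by positivity
      rw [hrec, Real.log_div (by positivity) (by positivity), Real.log_mul g1.ne' (by positivity),
        Real.log_mul (by norm_num) g1.ne', Real.log_pow, hrefl,
        Real.log_div (by positivity) g3.ne', Real.log_mul hpi.ne' h0,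
        Real.log_sqrt (by norm_num), show (1 / 4 : ℝ) = (2 ^ 2)⁻¹ by norm_num, Real.log_inv,
        Real.log_pow]
      push_cast
      ring
    rw [hval] at hlim
    refine hlim.congr' ?_
    filter_upwards [eventually_ne_atTop 0] with n hn
    rw [Pi.div_apply, ← prod_eq_GammaSeq n hn, Real.log_prod fun j _ => (hpos j).ne',
      Finset.mul_sum]
    exact Finset.sum_congr rfl fun j _ => by ring
  · intro j
    have hle : Real.log (1 - 1 / (2 * (j : ℝ) + 1 / 2 + 1) ^ 2) ≤ 0 := by
      refine Real.log_nonpos (hpos j).le ?_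
      rw [sub_le_self_iff]
      positivity
    linarith

theorem integral_lorentzianSechIntegral_sub :
    ∫ s in Set.Ioi 0, (lorentzianSechIntegral s - (1 / 2) / (s + 1 / 2)) =
      -(Real.log 2) / 2 - 2 * Real.log (Real.Gamma (3 / 4)) + Real.log Real.pi := by
  set F : ℕ → ℝ → ℝ := fun j s => (1 / 2) * (1 / (s + (2 * (j : ℝ) + 1 / 2)) -
      2 / (s + (2 * (j : ℝ) + 1 / 2) + 1) + 1 / (s + (2 * (j : ℝ) + 1 / 2) + 2))
  have hI (j : ℕ) : IntegrableOn (F j) (Set.Ioi 0) :=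
    integrableOn_second_difference (by positivity)
  have hval (j : ℕ) := integral_second_difference (y := 2 * (j : ℝ) + 1 / 2) (by positivity)
  have hnorm (j : ℕ) : ∫ s in Set.Ioi 0, ‖F j s‖ = ∫ s in Set.Ioi 0, F j s :=
    setIntegral_congr_fun measurableSet_Ioi fun s hs =>
      Real.norm_of_nonneg (second_difference_one_div_nonneg (by positivity) (le_of_lt hs))
  have hsum : Summable fun j => ∫ s in Set.Ioi 0, ‖F j s‖ := by
    simp only [hnorm, F, hval]
    exact hasSum_log_eq_log_Gamma.summable
  have h := hasSum_integral_of_summable_integral_norm hI hsum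
  have htsum : ∫ s in Set.Ioi 0, ∑' j, F j s =
      ∫ s in Set.Ioi 0, (lorentzianSechIntegral s - (1 / 2) / (s + 1 / 2)) :=
    setIntegral_congr_fun measurableSet_Ioi fun s hs =>
      (hasSum_lorentzianSechIntegral_sub hs).tsum_eq
  rw [← htsum]
  refine h.unique ?_
  simp only [F, hval]
  exact hasSum_log_eq_log_Gamma

theorem hasDerivAt_mul_exp_neg {r : ℝ} (hr : 0 < r) (v : ℝ) :
    HasDerivAt (fun v => -((v / r + 1 / r ^ 2) * Real.exp (-(r * v))))
      (v * Real.exp (-(r * v))) v := by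
  have h1 : HasDerivAt (fun v => -(r * v)) (-r) v := by
    simpa using (hasDerivAt_id v).const_mul (-r)
  convert! ((((hasDerivAt_id v).div_const r).add_const (1 / r ^ 2)).mul h1.exp).neg using 1
  simp only [id]
  field_simp
  ring

theorem tendsto_mul_exp_neg {r : ℝ} (hr : 0 < r) :
    Tendsto (fun v => -((v / r + 1 / r ^ 2) * Real.exp (-(r * v)))) atTop (𝓝 0) := by
  have h1 := (Real.tendsto_pow_mul_exp_neg_atTop_nhds_zero 1).comp
    (tendsto_id.const_mul_atTop hr)
  have h0 := (Real.tendsto_pow_mul_exp_neg_atTop_nhds_zero 0).comp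
    (tendsto_id.const_mul_atTop hr)
  convert! ((h1.add h0).const_mul (-(1 / r ^ 2))) using 2
  · simp only [Function.comp_apply, id]
    field_simp
  · simp

theorem integrableOn_mul_exp_neg {r : ℝ} (hr : 0 < r) :
    IntegrableOn (fun v => v * Real.exp (-(r * v))) (Set.Ioi 0) :=
  integrableOn_Ioi_deriv_of_nonneg' (fun _ _ => hasDerivAt_mul_exp_neg hr _)
    (fun _ hv => mul_nonneg (le_of_lt hv) (Real.exp_pos _).le) (tendsto_mul_exp_neg hr)

theorem integral_mul_exp_neg {r : ℝ} (hr : 0 < r) :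
    ∫ v in Set.Ioi 0, v * Real.exp (-(r * v)) = 1 / r ^ 2 := by
  rw [integral_Ioi_of_hasDerivAt_of_nonneg' (fun _ _ => hasDerivAt_mul_exp_neg hr _)
    (fun _ hv => mul_nonneg (le_of_lt hv) (Real.exp_pos _).le) (tendsto_mul_exp_neg hr)]
  simp

theorem integrableOn_mul_sech :
    IntegrableOn (fun v => v * (1 / Real.cosh (Real.pi * v))) (Set.Ioi 0) := by
  refine ((integrableOn_mul_exp_neg Real.pi_pos).const_mul 2).mono'
    (continuous_id.mul continuous_inv_cosh_pi_mul).aestronglyMeasurable ?_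
  refine (ae_restrict_iff' measurableSet_Ioi).2 (ae_of_all _ fun v hv => ?_)
  have hv' : 0 < v := hv
  have hc := Real.cosh_pos (Real.pi * v)
  rw [Real.norm_of_nonneg (by positivity), mul_left_comm]
  gcongr
  rw [Real.cosh_eq, Real.exp_neg, one_div_div, ← div_eq_mul_inv]
  gcongr
  simp [Real.exp_nonneg]

theorem hasSum_sech_exp {v : ℝ} (hv : 0 < v) :
    HasSum (fun k : ℕ => 2 * (-1 : ℝ) ^ k * Real.exp (-((2 * (k : ℝ) + 1) * Real.pi * v)))
      (1 / Real.cosh (Real.pi * v)) := by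
  have hlt : Real.exp (-(2 * (Real.pi * v))) < 1 := by
    rw [Real.exp_lt_one_iff, neg_lt_zero]
    exact mul_pos two_pos (mul_pos Real.pi_pos hv)
  have h := (hasSum_geometric_of_abs_lt_one (r := -Real.exp (-(2 * (Real.pi * v))))
    (by rwa [abs_neg, Real.abs_exp])).mul_left (2 * Real.exp (-(Real.pi * v)))
  convert! h using 1
  · ext k
    rw [neg_pow (Real.exp _), ← Real.exp_nat_mul, mul_right_comm, mul_assoc 2 (Real.exp _) (_ * _),
      mul_left_comm (Real.exp _), ← Real.exp_add]
    ring_nf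
  · have e : Real.exp (-(2 * (Real.pi * v))) = Real.exp (-(Real.pi * v)) ^ 2 := by
      rw [← Real.exp_nat_mul]
      ring_nf
    rw [Real.cosh_eq, e, Real.exp_neg, sub_neg_eq_add]
    have := Real.exp_pos (Real.pi * v)
    field_simp

theorem integral_mul_sech :
    ∫ v in Set.Ioi 0, v * (1 / Real.cosh (Real.pi * v)) = 2 / Real.pi ^ 2 * catalan' := by
  have hpi := Real.pi_pos
  set F : ℕ → ℝ → ℝ := fun k v =>
    2 * (-1 : ℝ) ^ k * (v * Real.exp (-((2 * (k : ℝ) + 1) * Real.pi * v)))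
  have hr (k : ℕ) : 0 < (2 * (k : ℝ) + 1) * Real.pi := by positivity
  have hI (k : ℕ) : IntegrableOn (F k) (Set.Ioi 0) :=
    (integrableOn_mul_exp_neg (hr k)).const_mul _
  have hval (k : ℕ) : ∫ v in Set.Ioi 0, F k v =
      2 / Real.pi ^ 2 * ((-1 : ℝ) ^ k / (2 * (k : ℝ) + 1) ^ 2) := by
    rw [integral_const_mul, integral_mul_exp_neg (hr k)]
    field_simp
  have hnorm (k : ℕ) : ∫ v in Set.Ioi 0, ‖F k v‖ =
      2 / Real.pi ^ 2 * (1 / (2 * (k : ℝ) + 1) ^ 2) := by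
    have : ∫ v in Set.Ioi 0, ‖F k v‖ =
        ∫ v in Set.Ioi 0, 2 * (v * Real.exp (-((2 * (k : ℝ) + 1) * Real.pi * v))) :=
      setIntegral_congr_fun measurableSet_Ioi fun v hv => by
        have hv' : 0 < v := hv
        simp [F, abs_of_pos hv']
    rw [this, integral_const_mul, integral_mul_exp_neg (hr k)]
    field_simp
  have hsum : Summable fun k => ∫ v in Set.Ioi 0, ‖F k v‖ := by
    simp only [hnorm]
    refine Summable.mul_left _ ?_
    refine Summable.of_nonneg_of_le (fun j => by positivity) (fun j => ?_)
      ((Real.summable_one_div_nat_add_rpow 1 2).2 (by norm_num))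
    have hj : (0 : ℝ) < (j : ℝ) + 1 := by positivity
    rw [abs_of_pos hj, Real.rpow_two]
    have : (j : ℝ) + 1 ≤ 2 * (j : ℝ) + 1 := by linarith [(Nat.cast_nonneg j : (0 : ℝ) ≤ j)]
    gcongr
  have h := (hasSum_integral_of_summable_integral_norm hI hsum).tsum_eq
  simp only [hval, tsum_mul_left] at h
  rw [catalan', h]
  refine setIntegral_congr_fun measurableSet_Ioi fun v hv => ?_
  have h2 := ((hasSum_sech_exp hv).mul_left v).tsum_eq
  refine h2.symm.trans (tsum_congr fun k => ?_)
  simp only [F]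
  ring

theorem hasDerivAt_arctan_add_arctan {v : ℝ} (hv : 0 < v) (s : ℝ) :
    HasDerivAt (fun s => Real.arctan (s / v) + Real.arctan ((s + 1) / v))
      (v / (v ^ 2 + s ^ 2) + v / (v ^ 2 + (s + 1) ^ 2)) s :=
  (hasDerivAt_arctan_div hv s).add ((hasDerivAt_arctan_div hv (s + 1)).comp_add_const s 1)

theorem tendsto_arctan_add_arctan {v : ℝ} (hv : 0 < v) :
    Tendsto (fun s => Real.arctan (s / v) + Real.arctan ((s + 1) / v)) atTop (𝓝 Real.pi) := by
  convert! (tendsto_arctan_div_atTop hv).add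
    ((tendsto_arctan_div_atTop hv).comp (tendsto_atTop_add_const_right _ 1 tendsto_id)) using 2
  ring

theorem integrableOn_shifted_lorentzians {v : ℝ} (hv : 0 < v) :
    IntegrableOn (fun s => v / (v ^ 2 + s ^ 2) + v / (v ^ 2 + (s + 1) ^ 2)) (Set.Ioi 0) :=
  integrableOn_Ioi_deriv_of_nonneg' (fun s _ => hasDerivAt_arctan_add_arctan hv s)
    (fun _ _ => by positivity) (tendsto_arctan_add_arctan hv)

theorem integral_shifted_lorentzians {v : ℝ} (hv : 0 < v) :
    ∫ s in Set.Ioi 0, (v / (v ^ 2 + s ^ 2) + v / (v ^ 2 + (s + 1) ^ 2)) =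
      Real.pi / 2 + Real.arctan v := by
  rw [integral_Ioi_of_hasDerivAt_of_nonneg' (fun s _ => hasDerivAt_arctan_add_arctan hv s)
    (fun _ _ => by positivity) (tendsto_arctan_add_arctan hv), zero_div, Real.arctan_zero,
    zero_add, zero_add, one_div, Real.arctan_inv_of_pos hv]
  ring

theorem integrableOn_mul_arctan_mul_sech :
    IntegrableOn (fun v => v * (1 / Real.cosh (Real.pi * v)) * Real.arctan v) (Set.Ioi 0) := by
  refine integrableOn_mul_sech.mul_bdd (c := Real.pi / 2)
    Real.continuous_arctan.aestronglyMeasurable (ae_of_all _ fun v => ?_)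
  rw [Real.norm_eq_abs, abs_le]
  exact ⟨(Real.neg_pi_div_two_lt_arctan v).le, (Real.arctan_lt_pi_div_two v).le⟩

theorem integral_mul_pi_div_two_add_arctan :
    ∫ v in Set.Ioi 0, (Real.pi / 2 * (v * (1 / Real.cosh (Real.pi * v))) +
        v * (1 / Real.cosh (Real.pi * v)) * Real.arctan v) =
      -(Real.log 2) / 2 - 2 * Real.log (Real.Gamma (3 / 4)) + Real.log Real.pi := by
  set K : ℝ → ℝ → ℝ := fun v s => v * (v / (v ^ 2 + s ^ 2) + v / (v ^ 2 + (s + 1) ^ 2)) *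
    (1 / Real.cosh (Real.pi * v)) with hK
  have hinner {v : ℝ} (hv : 0 < v) : ∫ s in Set.Ioi 0, K v s =
      Real.pi / 2 * (v * (1 / Real.cosh (Real.pi * v))) +
        v * (1 / Real.cosh (Real.pi * v)) * Real.arctan v := by
    simp only [hK]
    rw [integral_mul_const, integral_const_mul, integral_shifted_lorentzians hv]
    ring
  have hnonneg {v : ℝ} (hv : 0 < v) (s : ℝ) : 0 ≤ K v s := by
    have := Real.cosh_pos (Real.pi * v)
    positivity
  have hmeas : Measurable (Function.uncurry K) := by
    have hc : Measurable fun p : ℝ × ℝ => 1 / Real.cosh (Real.pi * p.1) :=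
      continuous_inv_cosh_pi_mul.measurable.comp measurable_fst
    simp only [hK, Function.uncurry_def]
    exact Measurable.mul (by fun_prop) hc
  have hint : Integrable (Function.uncurry K)
      ((volume.restrict (Set.Ioi (0 : ℝ))).prod (volume.restrict (Set.Ioi (0 : ℝ)))) := by
    rw [integrable_prod_iff hmeas.aestronglyMeasurable]
    constructor
    · refine (ae_restrict_iff' measurableSet_Ioi).2 (ae_of_all _ fun v hv => ?_)
      exact ((integrableOn_shifted_lorentzians hv).const_mul v).mul_const
        (1 / Real.cosh (Real.pi * v))
    · refine IntegrableOn.congr_fun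
        ((integrableOn_mul_sech.const_mul (Real.pi / 2)).add integrableOn_mul_arctan_mul_sech)
        (fun v hv => ?_) measurableSet_Ioi
      simp only [Function.uncurry_apply_pair, Real.norm_of_nonneg (hnonneg hv _)]
      exact (hinner hv).symm
  rw [← integral_lorentzianSechIntegral_sub,
    ← setIntegral_congr_fun measurableSet_Ioi fun v hv => hinner hv,
    integral_integral_swap hint]
  exact setIntegral_congr_fun measurableSet_Ioi fun s hs => integral_sq_lorentzian_div_cosh hs

/-- `∫_0^∞ v arctan v / cosh(πv) dv = -log(2)/2 - 2 log Γ(3/4) + log π - G/π`. -/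
theorem integral_v_arctan_v :
    ∫ v in Set.Ioi (0 : ℝ), v * Real.arctan v / Real.cosh (Real.pi * v) =
      -(Real.log 2) / 2 - 2 * Real.log (Real.Gamma (3 / 4)) + Real.log Real.pi -
        catalan' / Real.pi := by
  have h := integral_mul_pi_div_two_add_arctan
  rw [integral_add (integrableOn_mul_sech.const_mul _) integrableOn_mul_arctan_mul_sech,
    integral_const_mul, integral_mul_sech] at h
  have e (v : ℝ) : v * Real.arctan v / Real.cosh (Real.pi * v) =
      v * (1 / Real.cosh (Real.pi * v)) * Real.arctan v := by ring
  simp only [e]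
  have hG : Real.pi / 2 * (2 / Real.pi ^ 2 * catalan') = catalan' / Real.pi := by
    have := Real.pi_ne_zero
    field_simp
  rw [← h, hG, add_sub_cancel_left]
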